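/- Let k ≥ 2 and let y ∈ ℝ^{k−1} be badly approximable, i.e. there exists c(y) > 0 such that ‖p − q y‖^{k−1}·|q| ≥ c(y) for all p ∈ ℤ^{k−1} and all q ∈ ℤ. Let (X₁,…,X_k) be an orthonormal basis of euclidean ℝ^k with X₁ collinear to the vector (1,y) ∈ ℝ × ℝ^{k−1}, and for ε > 0 let ‖·‖_ε be the norm on ℝ^k defined by ‖v‖_ε² = ε²⟨v,X₁⟩² + ‖v − ⟨v,X₁⟩X₁‖² (i.e. the euclidean norm contracted by the factor ε in the direction X₁). Then there exist constants ε₀ > 0 and C > 0, depending only on y and k, such that for every ε < ε₀, min{ ‖v‖_ε : v ∈ ℤ^k, v ≠ 0 } ≥ C · ε^{1/k}; equivalently, the injectivity radius of the flat torus (ℝ^k/ℤ^k, ḡ_ε) is at least (C/2)·ε^{1/k}. -/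

import Mathlib

open scoped RealInnerProductSpace

/-- The projection `(q, p) ↦ p - q • y` of `ℝ × ℝⁿ` along `(1, y)` has norm at most
`1 + ‖y‖`. -/
lemma norm_tail_sub_smul_le {n : ℕ} (y : EuclideanSpace ℝ (Fin n))
    (z : EuclideanSpace ℝ (Fin (n + 1))) :
    ‖WithLp.toLp 2 (fun i : Fin n => z i.succ) - z 0 • y‖ ≤ (1 + ‖y‖) * ‖z‖ := by
  have h0 : ‖z 0‖ ≤ ‖z‖ := PiLp.norm_apply_le z 0
  have ht : ‖WithLp.toLp 2 (fun i : Fin n => z i.succ)‖ ≤ ‖z‖ := by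
    rw [EuclideanSpace.norm_eq, EuclideanSpace.norm_eq]
    apply Real.sqrt_le_sqrt
    rw [Fin.sum_univ_succ]
    exact le_add_of_nonneg_left (sq_nonneg _)
  calc _ ≤ ‖WithLp.toLp 2 (fun i : Fin n => z i.succ)‖ + ‖z 0 • y‖ := norm_sub_le _ _
    _ ≤ ‖z‖ + ‖z‖ * ‖y‖ := by
        rw [norm_smul]
        gcongr
    _ = _ := by ring

/-- A nonzero integer vector has euclidean norm at least one. -/
lemma one_le_norm_intCast {n : ℕ} {p : Fin n → ℤ} (hp : p ≠ 0) :
    1 ≤ ‖WithLp.toLp 2 (fun i => (p i : ℝ))‖ := by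
  obtain ⟨i, hi⟩ := Function.ne_iff.mp hp
  have h1 : (1 : ℝ) ≤ |(p i : ℝ)| := by exact_mod_cast Int.one_le_abs hi
  exact h1.trans (PiLp.norm_apply_le (WithLp.toLp 2 fun i => (p i : ℝ)) i)

/-- A vector with integer coordinates `(q, p)`, decomposed as `a • X + u` with `X` a unit vector
collinear to `(1, y)`, satisfies a lower bound on `ε` times a power of any `s` dominating both
`ε * |a|` and `‖u‖`. -/
lemma mul_le_of_abs_le_of_norm_le {n : ℕ} {y : EuclideanSpace ℝ (Fin n)} {c : ℝ}
    (hy : ∀ (p : Fin n → ℤ) (q : ℤ), q ≠ 0 →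
      c ≤ ‖WithLp.toLp 2 (fun i => (p i : ℝ)) - (q : ℝ) • y‖ ^ n * |(q : ℝ)|)
    {X u : EuclideanSpace ℝ (Fin (n + 1))} (hX : ‖X‖ = 1) (hXy : ∀ i, X (Fin.succ i) = X 0 * y i)
    {a s ε : ℝ} (hε : 0 < ε) (hε1 : ε ≤ 1) {v : Fin (n + 1) → ℤ} (hv : v ≠ 0)
    (hvu : WithLp.toLp 2 (fun i => (v i : ℝ)) = a • X + u)
    (ha : ε * |a| ≤ s) (hu : ‖u‖ ≤ s) :
    1 / (1 + ‖y‖) ≤ s ∨ c / (2 * (1 + ‖y‖) ^ n) * ε ≤ s ^ (n + 1) := by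
  have hM : 0 < 1 + ‖y‖ := by positivity
  have hs : 0 ≤ s := (norm_nonneg u).trans hu
  have hcoord : ∀ i, (v i : ℝ) = a * X i + u i := fun i => congrArg (fun z => z i) hvu
  have hproj : WithLp.toLp 2 (fun i : Fin n => (v i.succ : ℝ)) - (v 0 : ℝ) • y
      = WithLp.toLp 2 (fun i : Fin n => u i.succ) - u 0 • y := by
    ext i
    simp only [PiLp.sub_apply, PiLp.smul_apply, smul_eq_mul, hcoord, hXy]
    ring
  have hle : ‖WithLp.toLp 2 (fun i : Fin n => (v i.succ : ℝ)) - (v 0 : ℝ) • y‖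
      ≤ (1 + ‖y‖) * s := by
    rw [hproj]
    exact (norm_tail_sub_smul_le y u).trans (by gcongr)
  by_cases hq : v 0 = 0
  · left
    have hp : (fun i : Fin n => v i.succ) ≠ 0 := by
      intro h
      apply hv
      ext i
      exact Fin.cases hq (fun j => congrFun h j) i
    rw [div_le_iff₀' hM]
    refine (one_le_norm_intCast hp).trans ?_
    simpa [hq] using hle
  · right
    have hX0 : |X 0| ≤ 1 := hX ▸ PiLp.norm_apply_le X 0
    have hu0 : |u 0| ≤ s := (PiLp.norm_apply_le u 0).trans hu
    have hq_le : ε * |(v 0 : ℝ)| ≤ 2 * s := by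
      calc ε * |(v 0 : ℝ)| ≤ ε * (|a| * |X 0| + |u 0|) := by
            rw [hcoord, ← abs_mul]
            gcongr
            exact abs_add_le _ _
        _ ≤ ε * (|a| * 1 + |u 0|) := by gcongr
        _ = ε * |a| + ε * |u 0| := by ring
        _ ≤ s + 1 * s := by gcongr
        _ = 2 * s := by ring
    rw [div_mul_eq_mul_div, div_le_iff₀ (by positivity)]
    calc c * ε ≤ ((1 + ‖y‖) * s) ^ n * |(v 0 : ℝ)| * ε := by
          gcongr
          exact (hy (fun i => v i.succ) (v 0) hq).trans (by gcongr)
      _ = ((1 + ‖y‖) * s) ^ n * (ε * |(v 0 : ℝ)|) := by ring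
      _ ≤ ((1 + ‖y‖) * s) ^ n * (2 * s) := by gcongr
      _ = _ := by rw [mul_pow]; ring

/-- Let `k ≥ 2` and let `y ∈ ℝ^{k−1}` be badly approximable: there is
`c(y) > 0` with `‖p − q·y‖^{k−1}·|q| ≥ c(y)` for all `p ∈ ℤ^{k−1}` and all
`q ∈ ℤ`, `q ≠ 0`.  Let `(X₁,…,X_k)` be an orthonormal basis of euclidean
`ℝ^k` with `X₁` collinear to the vector `(1,y) ∈ ℝ × ℝ^{k−1}` (identifying
`ℤ^{k−1} × ℤ ≅ ℤ^k` via `(p,q) ↦ (q,p)`), and for `ε > 0` let `‖·‖_ε` be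
the norm on `ℝ^k` with
`‖v‖_ε² = ε²·⟨v,X₁⟩² + ‖v − ⟨v,X₁⟩X₁‖²`
(the euclidean norm contracted by the factor `ε` in the direction `X₁`).
Then there exist `ε₀ > 0` and `C > 0`, depending only on `y` and `k`, such
that for every `0 < ε < ε₀`:
`min{ ‖v‖_ε : v ∈ ℤ^k, v ≠ 0 } ≥ C·ε^{1/k}`
(equivalently, the injectivity radius of the flat torus `(ℝ^k/ℤ^k, ḡ_ε)`
is at least `(C/2)·ε^{1/k}`). -/
theorem badly_approximable_contraction_lattice_norm_lower_bound
    (k : ℕ) (hk : 2 ≤ k)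
    (y : EuclideanSpace ℝ (Fin (k - 1)))
    (c : ℝ) (hc : 0 < c)
    (hy : ∀ (p : Fin (k - 1) → ℤ) (q : ℤ), q ≠ 0 →
      c ≤ ‖(WithLp.equiv 2 (Fin (k - 1) → ℝ)).symm (fun i => (p i : ℝ)) -
            (q : ℝ) • y‖ ^ (k - 1) * |(q : ℝ)|)
    (X₁ : EuclideanSpace ℝ (Fin k)) (hX₁ : ‖X₁‖ = 1)
    (hcol : ∃ t : ℝ, X₁ = t • (WithLp.equiv 2 (Fin k → ℝ)).symm
      (fun i => if h : (i : ℕ) = 0 then (1 : ℝ)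
        else y ⟨(i : ℕ) - 1, by have := i.isLt; omega⟩)) :
    ∃ ε₀ C : ℝ, 0 < ε₀ ∧ 0 < C ∧
      ∀ ε : ℝ, 0 < ε → ε < ε₀ →
        ∀ v : Fin k → ℤ, v ≠ 0 →
          C * ε ^ ((1 : ℝ) / (k : ℝ)) ≤
            Real.sqrt
              (ε ^ 2 *
                  ⟪(WithLp.equiv 2 (Fin k → ℝ)).symm (fun i => (v i : ℝ)),
                    X₁⟫ ^ 2 +
                ‖(WithLp.equiv 2 (Fin k → ℝ)).symm (fun i => (v i : ℝ)) -
                    ⟪(WithLp.equiv 2 (Fin k → ℝ)).symm (fun i => (v i : ℝ)),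
                      X₁⟫ • X₁‖ ^ 2) := by
  obtain ⟨n, rfl⟩ : ∃ n, k = n + 1 := ⟨k - 1, by omega⟩
  change EuclideanSpace ℝ (Fin n) at y
  obtain ⟨t, ht⟩ := hcol
  have hXy : ∀ i : Fin n, X₁ i.succ = X₁ 0 * y i := by
    intro i
    rw [ht]
    simp
  have hM : 0 < 1 + ‖y‖ := by positivity
  set D := c / (2 * (1 + ‖y‖) ^ n)
  have hD0 : 0 < D := by positivity
  refine ⟨1, min (1 / (1 + ‖y‖)) (D ^ ((1 : ℝ) / ((n + 1 : ℕ) : ℝ))), one_pos,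
    by positivity, fun ε hε hε1 v hv => ?_⟩
  set V : EuclideanSpace ℝ (Fin (n + 1)) :=
    (WithLp.equiv 2 (Fin (n + 1) → ℝ)).symm (fun i => (v i : ℝ))
  set a := ⟪V, X₁⟫
  set s := Real.sqrt (ε ^ 2 * a ^ 2 + ‖V - a • X₁‖ ^ 2)
  have hs : 0 ≤ s := Real.sqrt_nonneg _
  have ha : ε * |a| ≤ s := by
    apply Real.le_sqrt_of_sq_le
    rw [mul_pow, sq_abs]
    exact le_add_of_nonneg_right (sq_nonneg _)
  have hu : ‖V - a • X₁‖ ≤ s :=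
    Real.le_sqrt_of_sq_le (le_add_of_nonneg_left (by positivity))
  rcases mul_le_of_abs_le_of_norm_le hy hX₁ hXy hε hε1.le hv
    (add_sub_cancel (a • X₁) V).symm ha hu with h | h
  · calc _ ≤ 1 / (1 + ‖y‖) * 1 := by
          gcongr
          · exact min_le_left _ _
          · exact Real.rpow_le_one hε.le hε1.le (by positivity)
      _ ≤ s := by rwa [mul_one]
  · calc _ ≤ D ^ ((1 : ℝ) / ((n + 1 : ℕ) : ℝ)) * ε ^ ((1 : ℝ) / ((n + 1 : ℕ) : ℝ)) := by
          gcongr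
          exact min_le_right _ _
      _ = (D * ε) ^ ((1 : ℝ) / ((n + 1 : ℕ) : ℝ)) := (Real.mul_rpow hD0.le hε.le).symm
      _ ≤ (s ^ (n + 1)) ^ ((1 : ℝ) / ((n + 1 : ℕ) : ℝ)) := by gcongr; exact h
      _ = s := by rw [one_div, Real.pow_rpow_inv_natCast hs n.succ_ne_zero]
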